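/- arXiv:2204.08410 — 7 statements merged into one kernel-verified Lean document; each statement's English description precedes it below -/
import Mathlib

section
/- For α ∈ D^×, let A_{2,α} be the algebra on D² with natural basis {e₁,e₂} and multiplication e₁² = e₂, e₂² = α e₁, e₁e₂ = e₂e₁ = 0. For α, β ∈ D^×, the algebras A_{2,α} and A_{2,β} are isomorphic if and only if there exists k ∈ D^× such that β = k³α or β = k³α². -/
/-- The two-dimensional evolution algebra multiplication on `D × D` with natural basis
`e₁ = (1,0)`, `e₂ = (0,1)` determined by `e₁² = a•e₁ + b•e₂`, `e₂² = c•e₁ + d•e₂` and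
`e₁e₂ = e₂e₁ = 0`. -/
def evMul {D : Type*} [CommRing D] (a b c d : D) (x y : D × D) : D × D :=
  (a * (x.1 * y.1) + c * (x.2 * y.2), b * (x.1 * y.1) + d * (x.2 * y.2))

/-- Two such evolution algebras are isomorphic if there is a bijective `D`-linear map
`D × D → D × D` preserving the multiplications. -/
def EvIso {D : Type*} [CommRing D] (a b c d a' b' c' d' : D) : Prop :=
  ∃ f : (D × D) ≃ₗ[D] (D × D),
    ∀ x y : D × D, f (evMul a b c d x y) = evMul a' b' c' d' (f x) (f y)


/-- The diagonal change of basis `(x, y) ↦ (u x, v y)`. -/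
def diagEquiv {D : Type*} [CommRing D] (u v : Dˣ) : (D × D) ≃ₗ[D] (D × D) :=
  (LinearEquiv.smulOfUnit u).prodCongr (LinearEquiv.smulOfUnit v)

@[simp]
theorem diagEquiv_apply {D : Type*} [CommRing D] (u v : Dˣ) (x : D × D) :
    diagEquiv u v x = (u * x.1, v * x.2) := rfl

theorem evIso_of_eq_cube_mul {D : Type*} [CommRing D] (k : Dˣ) (α : D) :
    EvIso 0 1 α 0 0 1 ((k : D) ^ 3 * α) 0 := by
  refine ⟨diagEquiv k⁻¹ (k⁻¹ ^ 2), fun x y => ?_⟩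
  have hk := k.mul_inv
  ext
  · simp only [evMul, diagEquiv_apply, Units.val_pow_eq_pow_val]
    grind
  · simp only [evMul, diagEquiv_apply, Units.val_pow_eq_pow_val]
    grind

theorem evIso_of_eq_cube_mul_sq {D : Type*} [CommRing D] (k α : Dˣ) :
    EvIso 0 1 (α : D) 0 0 1 ((k : D) ^ 3 * (α : D) ^ 2) 0 := by
  refine ⟨(LinearEquiv.prodComm D D D).trans (diagEquiv k⁻¹ (k⁻¹ ^ 2 * α⁻¹)), fun x y => ?_⟩
  have hk := k.mul_inv
  have hα := α.mul_inv
  ext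
  · simp only [evMul, LinearEquiv.trans_apply, LinearEquiv.prodComm_apply, Prod.fst_swap,
      Prod.snd_swap, diagEquiv_apply, Units.val_mul, Units.val_pow_eq_pow_val]
    generalize ((k⁻¹ : Dˣ) : D) = l at *
    generalize ((α⁻¹ : Dˣ) : D) = γ at *
    have h : (k : D) ^ 3 * (α : D) ^ 2 * (l ^ 2 * γ * (l ^ 2 * γ)) = l := by
      calc _ = (k * l) ^ 3 * (α * γ) ^ 2 * l := by ring
        _ = l := by rw [hk, hα]; ring
    linear_combination (-x.1 * y.1) * h
  · simp only [evMul, LinearEquiv.trans_apply, LinearEquiv.prodComm_apply, Prod.fst_swap,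
      Prod.snd_swap, diagEquiv_apply, Units.val_mul, Units.val_pow_eq_pow_val]
    generalize ((k⁻¹ : Dˣ) : D) = l at *
    generalize ((α⁻¹ : Dˣ) : D) = γ at *
    linear_combination (l ^ 2 * x.2 * y.2) * hα

/-- The coordinates `(p, q)` of the image of `e₁` under an isomorphism. -/
theorem EvIso.exists_coords {D : Type*} [CommRing D] [Nontrivial D] {α β : D}
    (h : EvIso 0 1 α 0 0 1 β 0) :
    ∃ p q : D, (p ≠ 0 ∨ q ≠ 0) ∧ α * p = β * p ^ 4 ∧
      α * q = β ^ 2 * q ^ 4 := by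
  obtain ⟨f, hf⟩ := h
  obtain ⟨p, q, h₁⟩ : ∃ p q, f (1, 0) = (p, q) := ⟨_, _, rfl⟩
  have h₂ : f (0, 1) = (β * q ^ 2, p ^ 2) := by
    simpa [evMul, h₁, sq] using hf (1, 0) (1, 0)
  have hα : f (α, 0) = (α * p, α * q) := by
    have := f.map_smul α (1, 0)
    simpa [h₁] using this
  have h₂₂ := hf (0, 1) (0, 1)
  simp only [evMul, h₂, mul_one, mul_zero, zero_mul, add_zero, zero_add, hα, Prod.mk.injEq,
    one_mul] at h₂₂
  have hne : p ≠ 0 ∨ q ≠ 0 := by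
    by_contra! h
    have : f (1, 0) = 0 := by rw [h₁, h.1, h.2]; rfl
    simp at this
  exact ⟨p, q, hne, by linear_combination h₂₂.1, by linear_combination h₂₂.2⟩

/-- For `α ∈ D^×`, `A_{2,α}` has `e₁² = e₂`, `e₂² = α e₁`.  For units `α, β`,
`A_{2,α} ≅ A_{2,β}` iff `β = k³α` or `β = k³α²` for some unit `k`. -/
theorem stmt12 {D : Type*} [CommRing D] [IsDomain D] (α β : D)
    (hα : IsUnit α) (hβ : IsUnit β) :
    EvIso 0 1 α 0 0 1 β 0 ↔
      ∃ k : Dˣ, β = (k : D) ^ 3 * α ∨ β = (k : D) ^ 3 * α ^ 2 := by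
  obtain ⟨α, rfl⟩ := hα
  obtain ⟨β, rfl⟩ := hβ
  constructor
  · intro h
    obtain ⟨p, q, hne, hp, hq⟩ := h.exists_coords
    rcases hne with hp₀ | hq₀
    · have h : (α : D) = β * p ^ 3 := mul_right_cancel₀ hp₀ (by linear_combination hp)
      have hu : IsUnit p := by
        have : IsUnit ((β : D) * p ^ 3) := h ▸ α.isUnit
        exact (isUnit_pow_iff three_ne_zero).1 (isUnit_of_mul_isUnit_right this)
      obtain ⟨p, rfl⟩ := hu
      refine ⟨p⁻¹, Or.inl ?_⟩
      norm_cast at h ⊢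
      rw [h, inv_pow, mul_comm β, inv_mul_cancel_left]
    · have h : (α : D) = β ^ 2 * q ^ 3 := mul_right_cancel₀ hq₀ (by linear_combination hq)
      have hu : IsUnit q := by
        have : IsUnit ((β : D) ^ 2 * q ^ 3) := h ▸ α.isUnit
        exact (isUnit_pow_iff three_ne_zero).1 (isUnit_of_mul_isUnit_right this)
      obtain ⟨q, rfl⟩ := hu
      refine ⟨β * q * α⁻¹, Or.inr ?_⟩
      norm_cast at h ⊢
      calc β = β ^ 3 * q ^ 3 * (β ^ 2 * q ^ 3)⁻¹ := by
            rw [eq_mul_inv_iff_mul_eq, pow_succ' β 2, mul_assoc]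
        _ = (β * q * α⁻¹) ^ 3 * α ^ 2 := by
            rw [← h, mul_pow, mul_pow, inv_pow, pow_succ' α 2, mul_inv, mul_assoc (β ^ 3 * q ^ 3),
              inv_mul_cancel_right]
  · rintro ⟨k, h | h⟩
    · exact h ▸ evIso_of_eq_cube_mul k _
    · exact h ▸ evIso_of_eq_cube_mul_sq k α
end

section
/- For λ ∈ D^*, let A_{3,λ} be the algebra on D² with natural basis {e₁,e₂} and multiplication e₁² = e₁, e₂² = λe₁ + e₂, e₁e₂ = e₂e₁ = 0. For λ, μ ∈ D^*, the algebras A_{3,λ} and A_{3,μ} are isomorphic if and only if λ = μ. -/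
/-- For `λ ∈ D^*`, `A_{3,λ}` has `e₁² = e₁`, `e₂² = λe₁ + e₂`.  For `λ, μ ∈ D^*`,
`A_{3,λ} ≅ A_{3,μ}` iff `λ = μ`. -/
theorem stmt13 {D : Type*} [CommRing D] [IsDomain D] (l μ : D)
    (hl : l ≠ 0) (hμ : μ ≠ 0) :
    EvIso 1 0 l 1 1 0 μ 1 ↔ l = μ := by
  constructor
  · rintro ⟨f, hf⟩
    have h11 := hf (1, 0) (1, 0)
    have h12 := hf (1, 0) (0, 1)
    have h22 := hf (0, 1) (0, 1)
    have h1 : f (1, 0) ≠ 0 := by simp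
    have h2 : f (0, 1) ≠ 0 := by simp
    have hl1 : f (l, 1) = l • f (1, 0) + f (0, 1) := by
      rw [← map_smul, ← map_add]
      simp
    rcases hp : f (1, 0) with ⟨p, q⟩
    rcases hr : f (0, 1) with ⟨r, s⟩
    simp only [evMul, mul_one, mul_zero, zero_mul, one_mul, add_zero, zero_add, hp, hr, hl1,
      Prod.mk_zero_zero, map_zero, Prod.smul_mk, Prod.mk_add_mk, smul_eq_mul, Prod.ext_iff,
      Prod.fst_zero, Prod.snd_zero, ne_eq] at h11 h12 h22 h1 h2
    obtain ⟨hp2, hq2⟩ := h11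
    obtain ⟨hpr, hqs⟩ := h12
    obtain ⟨hr2, hs2⟩ := h22
    obtain rfl : q = 0 := by
      rcases mul_eq_zero.1 hqs.symm with h | rfl
      · exact h
      · have hlq : l * q = 0 := by linear_combination hs2
        exact (mul_eq_zero.1 hlq).resolve_left hl
    have hp0 : p ≠ 0 := fun h => h1 ⟨h, rfl⟩
    obtain rfl : p = 1 := mul_left_cancel₀ hp0 (by linear_combination -hp2)
    obtain rfl : r = 0 := by linear_combination -hpr
    have hs0 : s ≠ 0 := fun h => h2 ⟨rfl, h⟩
    obtain rfl : s = 1 := mul_left_cancel₀ hs0 (by linear_combination -hs2)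
    linear_combination hr2
  · rintro rfl
    exact ⟨LinearEquiv.refl D (D × D), fun _ _ => rfl⟩
end

section
/- For λ ∈ D^×, let A(λ,1,1) be the algebra on D² with natural basis {e₁,e₂} and multiplication e₁² = λe₂, e₂² = e₁ + e₂, e₁e₂ = e₂e₁ = 0. For λ, μ ∈ D^×, the algebras A(λ,1,1) and A(μ,1,1) are isomorphic if and only if λ = μ. -/
/-- For `λ ∈ D^×`, `A(λ,1,1)` has `e₁² = λe₂`, `e₂² = e₁ + e₂`.  For units `λ, μ`,
`A(λ,1,1) ≅ A(μ,1,1)` iff `λ = μ`. -/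
theorem stmt14 {D : Type*} [CommRing D] [IsDomain D] (l μ : D)
    (hl : IsUnit l) (hμ : IsUnit μ) :
    EvIso 0 l 1 1 0 μ 1 1 ↔ l = μ := by
  constructor
  · rintro ⟨f, hf⟩
    have h11 := hf (1, 0) (1, 0)
    have h12 := hf (1, 0) (0, 1)
    have h22 := hf (0, 1) (0, 1)
    have n1 : f (1, 0) ≠ 0 := by simp [Prod.ext_iff]
    have n2 : f (0, 1) ≠ 0 := by simp [Prod.ext_iff]
    have e11 : evMul 0 l 1 1 ((1, 0) : D × D) (1, 0) = l • ((0, 1) : D × D) := by simp [evMul]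
    have e12 : evMul 0 l 1 1 ((1, 0) : D × D) (0, 1) = 0 := by simp [evMul]
    have e22 : evMul 0 l 1 1 ((0, 1) : D × D) (0, 1) = (1, 0) + (0, 1) := by simp [evMul]
    rw [e11, map_smul] at h11
    rw [e12, map_zero] at h12
    rw [e22, map_add] at h22
    generalize f (1, 0) = u at *
    generalize f (0, 1) = v at *
    obtain ⟨p, q⟩ := u
    obtain ⟨r, s⟩ := v
    simp only [evMul, Prod.smul_mk, smul_eq_mul, Prod.mk_add_mk, zero_mul, zero_add,
      one_mul, Prod.ext_iff, Prod.fst_zero, Prod.snd_zero, ne_eq] at h11 h12 h22 n1 n2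
    have hl0 := hl.ne_zero
    have hμ0 := hμ.ne_zero
    obtain ⟨hlr, hls⟩ := h11
    obtain ⟨hqs, hpr⟩ := h12
    obtain ⟨hp, hq⟩ := h22
    have hpr0 : p * r = 0 := by
      rw [← hqs, add_zero] at hpr
      exact (mul_eq_zero.mp hpr.symm).resolve_left hμ0
    rcases mul_eq_zero.mp hqs.symm with rfl | rfl
    · obtain rfl : r = 0 := by simpa [hl0] using hlr
      simp only [add_zero, mul_zero, zero_add] at hp hq hls
      have hps : p = s := hp.trans hq.symm
      subst hps
      have hp0 : p ≠ 0 := fun h => n1 ⟨h, rfl⟩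
      have hp1 : p = 1 := (mul_eq_left₀ hp0).mp hq.symm
      simpa [hp1] using hls
    · have hr : r = 0 := by
        have hprs : p = -r := by linear_combination hp
        simpa [hprs] using hpr0
      exact absurd ⟨hr, rfl⟩ n2
  · rintro rfl
    exact ⟨LinearEquiv.refl D _, fun _ _ => rfl⟩
end

section
/- For λ ∈ D^× and μ ∈ D^*∖D^×, let A(1,λ,μ) be the algebra on D² with natural basis {e₁,e₂} and multiplication e₁² = e₂, e₂² = λe₁ + μe₂, e₁e₂ = e₂e₁ = 0. For λ, λ' ∈ D^× and μ, μ' ∈ D^*∖D^×, the algebras A(1,λ,μ) and A(1,λ',μ') are isomorphic if and only if there exists k ∈ D^× such that λ' = k³λ and μ' = k²μ. -/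
/-- Scaling the coordinates of `D × D` by two units is a linear automorphism. -/
def diagScale {D : Type*} [CommRing D] (u v : Dˣ) : (D × D) ≃ₗ[D] (D × D) :=
  (LinearEquiv.smulOfUnit u).prodCongr (LinearEquiv.smulOfUnit v)

theorem diagScale_apply {D : Type*} [CommRing D] (u v : Dˣ) (x : D × D) :
    diagScale u v x = ((u : D) * x.1, (v : D) * x.2) := rfl


/-- For `λ ∈ D^×` and `μ ∈ D^* \ D^×`, `A(1,λ,μ)` has `e₁² = e₂`, `e₂² = λe₁ + μe₂`.
`A(1,λ,μ) ≅ A(1,λ',μ')` iff `λ' = k³λ` and `μ' = k²μ` for some unit `k`. -/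
theorem stmt15 {D : Type*} [CommRing D] [IsDomain D] (l μ l' μ' : D)
    (hl : IsUnit l) (hl' : IsUnit l')
    (hμ : μ ≠ 0 ∧ ¬ IsUnit μ) (hμ' : μ' ≠ 0 ∧ ¬ IsUnit μ') :
    EvIso 0 1 l μ 0 1 l' μ' ↔
      ∃ k : Dˣ, l' = (k : D) ^ 3 * l ∧ μ' = (k : D) ^ 2 * μ := by
  constructor
  · rintro ⟨f, hf⟩
    obtain ⟨⟨p, q⟩, he₁⟩ : ∃ z, f (1, 0) = z := ⟨_, rfl⟩
    obtain ⟨⟨r, s⟩, he₂⟩ : ∃ z, f (0, 1) = z := ⟨_, rfl⟩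
    have hlin : f (l, μ) = (l * p + μ * r, l * q + μ * s) := by
      have h : ((l, μ) : D × D) = l • (1, 0) + μ • (0, 1) := by simp
      rw [h, map_add, map_smul, map_smul, he₁, he₂]
      simp
    have h₁₁ := hf (1, 0) (1, 0)
    have h₁₂ := hf (1, 0) (0, 1)
    have h₂₂ := hf (0, 1) (0, 1)
    have hzero : f (0, 0) = (0, 0) := map_zero f
    simp only [evMul, mul_one, mul_zero, zero_mul, add_zero, zero_add, one_mul, he₁, he₂, hlin,
      hzero, Prod.mk.injEq] at h₁₁ h₁₂ h₂₂
    obtain ⟨hr, hs⟩ := h₁₁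
    obtain ⟨hqs, hprqs⟩ := h₁₂
    obtain ⟨hl₂, hμ₂⟩ := h₂₂
    have hqs' : q * s = 0 := (mul_eq_zero.1 hqs.symm).resolve_left hl'.ne_zero
    have hpr : p * r = 0 := by simpa [hqs'] using hprqs.symm
    by_cases hq : q = 0
    · subst hq
      obtain rfl : r = 0 := by simpa using hr
      obtain rfl : s = p * p := by simpa using hs
      have hp : p ≠ 0 := by
        rintro rfl
        have h : ((1, 0) : D × D) = 0 := f.map_eq_zero_iff.1 he₁
        simp at h
      have hlp : l = l' * p ^ 3 := mul_right_cancel₀ hp (by linear_combination hl₂)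
      have hμp : μ = μ' * p ^ 2 :=
        mul_right_cancel₀ (mul_ne_zero hp hp) (by linear_combination hμ₂)
      have hpu : IsUnit p :=
        (isUnit_pow_iff three_ne_zero).1 (isUnit_of_mul_isUnit_right (hlp ▸ hl))
      obtain ⟨u, rfl⟩ := hpu
      have hu : ((u⁻¹ : Dˣ) : D) * u = 1 := u.inv_mul
      refine ⟨u⁻¹, ?_, ?_⟩
      · rw [hlp, mul_left_comm, ← mul_pow, hu, one_pow, mul_one]
      · rw [hμp, mul_left_comm, ← mul_pow, hu, one_pow, mul_one]
    · obtain rfl : s = 0 := (mul_eq_zero.1 hqs').resolve_left hq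
      have hr₀ : r ≠ 0 := hr ▸ mul_ne_zero hl'.ne_zero (mul_ne_zero hq hq)
      obtain rfl : p = 0 := (mul_eq_zero.1 hpr).resolve_right hr₀
      have h : μ' * (q * q) = 0 := by simpa using hs.symm
      exact absurd h (mul_ne_zero hμ'.1 (mul_ne_zero hq hq))
  · rintro ⟨k, rfl, rfl⟩
    have hk : ((k⁻¹ : Dˣ) : D) * k = 1 := k.inv_mul
    refine ⟨diagScale k⁻¹ (k⁻¹ ^ 2), fun x y => ?_⟩
    simp only [diagScale_apply, evMul, Units.val_pow_eq_pow_val]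
    generalize ((k⁻¹ : Dˣ) : D) = p at hk ⊢
    have h₂ : p ^ 2 * (k : D) ^ 2 = 1 := by rw [← mul_pow, hk, one_pow]
    have h₃ : p ^ 3 * (k : D) ^ 3 = 1 := by rw [← mul_pow, hk, one_pow]
    ext
    · linear_combination (-(p * l * x.2 * y.2)) * h₃
    · linear_combination (-(p ^ 2 * μ * x.2 * y.2)) * h₂
end

section
/- For λ, μ ∈ D^* with 1 − λμ ∈ D^×, let B(1,λ,μ,1) be the algebra on D² with natural basis {e₁,e₂} and multiplication e₁² = e₁ + λe₂, e₂² = μe₁ + e₂, e₁e₂ = e₂e₁ = 0. For λ, μ, λ', μ' ∈ D^* with 1 − λμ ∈ D^× and 1 − λ'μ' ∈ D^×, the algebras B(1,λ,μ,1) and B(1,λ',μ',1) are isomorphic if and only if (λ,μ) = (λ',μ') or (λ,μ) = (μ',λ'). -/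
/-- The `D`-linear equivalence swapping the two basis vectors carries `B(a,b,c,d)` to
`B(d,c,b,a)`. -/
theorem evIso_swap {D : Type*} [CommRing D] (a b c d : D) : EvIso a b c d d c b a := by
  refine ⟨LinearEquiv.prodComm D D D, fun x y => ?_⟩
  ext <;> simp [evMul] <;> ring

theorem evIso_refl {D : Type*} [CommRing D] (a b c d : D) : EvIso a b c d a b c d :=
  ⟨LinearEquiv.refl D (D × D), fun _ _ => rfl⟩

/-- In a perfect evolution algebra over a domain, orthogonal vectors are coordinatewise orthogonal. -/
theorem mul_eq_zero_of_evMul_eq_zero {D : Type*} [CommRing D] [IsDomain D] {l μ : D}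
    (h : IsUnit (1 - l * μ)) {x y : D × D} (hxy : evMul 1 l μ 1 x y = 0) :
    x.1 * y.1 = 0 ∧ x.2 * y.2 = 0 := by
  have h₁ : 1 * (x.1 * y.1) + μ * (x.2 * y.2) = 0 := congrArg Prod.fst hxy
  have h₂ : l * (x.1 * y.1) + 1 * (x.2 * y.2) = 0 := congrArg Prod.snd hxy
  constructor <;> refine (mul_eq_zero.mp ?_).resolve_left h.ne_zero
  · linear_combination h₁ - μ * h₂
  · linear_combination h₂ - l * h₁

/-- For `λ, μ ∈ D^*` with `1 - λμ ∈ D^×`, `B(1,λ,μ,1)` has `e₁² = e₁ + λe₂`,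
`e₂² = μe₁ + e₂`.  `B(1,λ,μ,1) ≅ B(1,λ',μ',1)` iff `(λ,μ) = (λ',μ')` or `(λ,μ) = (μ',λ')`. -/
theorem stmt16 {D : Type*} [CommRing D] [IsDomain D] (l μ l' μ' : D)
    (hl : l ≠ 0) (hμ : μ ≠ 0) (hl' : l' ≠ 0) (hμ' : μ' ≠ 0)
    (h : IsUnit (1 - l * μ)) (h' : IsUnit (1 - l' * μ')) :
    EvIso 1 l μ 1 1 l' μ' 1 ↔ ((l, μ) = (l', μ') ∨ (l, μ) = (μ', l')) := by
  constructor
  · rintro ⟨f, hf⟩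
    obtain ⟨p, q, hpq⟩ : ∃ p q, f (1, 0) = (p, q) := ⟨_, _, rfl⟩
    obtain ⟨r, s, hrs⟩ : ∃ r s, f (0, 1) = (r, s) := ⟨_, _, rfl⟩
    have map_pair (a b : D) : f (a, b) = (a * p + b * r, a * q + b * s) := by
      have hab : ((a, b) : D × D) = a • (1, 0) + b • (0, 1) := by simp
      rw [hab, map_add, map_smul, map_smul, hpq, hrs]
      simp
    have hpq_ne : (p, q) ≠ 0 := by
      rw [← hpq]
      simp
    have hrs_ne : (r, s) ≠ 0 := by
      rw [← hrs]
      simp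
    have h₁₂ := hf (1, 0) (0, 1)
    have h₁₁ := hf (1, 0) (1, 0)
    have h₂₂ := hf (0, 1) (0, 1)
    have hzero : evMul 1 l' μ' 1 (p, q) (r, s) = 0 := by
      rw [← hpq, ← hrs, ← h₁₂]
      simp [evMul]
    obtain ⟨hpr, hqs⟩ := mul_eq_zero_of_evMul_eq_zero h' hzero
    simp only [evMul, map_pair, Prod.mk.injEq] at h₁₁ h₂₂
    simp only [ne_eq, Prod.mk_eq_zero, mul_eq_zero] at hpq_ne hrs_ne hpr hqs
    obtain ⟨h₁, h₂⟩ := h₁₁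
    obtain ⟨h₃, h₄⟩ := h₂₂
    have hcases : (q = 0 ∧ r = 0 ∧ p ≠ 0 ∧ s ≠ 0) ∨ (p = 0 ∧ s = 0 ∧ q ≠ 0 ∧ r ≠ 0) := by
      tauto
    rcases hcases with ⟨rfl, rfl, hp, hs⟩ | ⟨rfl, rfl, hq, hr⟩
    · have hp1 : p = 1 := mul_left_cancel₀ hp (by linear_combination -h₁)
      have hs1 : s = 1 := mul_left_cancel₀ hs (by linear_combination -h₄)
      subst hp1 hs1
      left
      ext
      · linear_combination h₂
      · linear_combination h₃
    · have hq1 : q = 1 := mul_left_cancel₀ hq (by linear_combination -h₂)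
      have hr1 : r = 1 := mul_left_cancel₀ hr (by linear_combination -h₃)
      subst hq1 hr1
      right
      ext
      · linear_combination h₁
      · linear_combination h₄
  · rintro (hlμ | hlμ) <;> obtain ⟨rfl, rfl⟩ := Prod.mk.inj hlμ
    · exact evIso_refl 1 l μ 1
    · exact evIso_swap 1 l μ 1
end

section
/- For λ ∈ D^* and μ ∈ D^*∖D^× with λ − μ ∈ D^×, let B(1,1,λ,μ) be the algebra on D² with natural basis {e₁,e₂} and multiplication e₁² = e₁ + e₂, e₂² = λe₁ + μe₂, e₁e₂ = e₂e₁ = 0. For λ, λ' ∈ D^* and μ, μ' ∈ D^*∖D^× with λ − μ ∈ D^× and λ' − μ' ∈ D^×, the algebras B(1,1,λ,μ) and B(1,1,λ',μ') are isomorphic if and only if (λ,μ) = (λ',μ'). -/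
/-- For `λ ∈ D^*` and `μ ∈ D^* \ D^×` with `λ - μ ∈ D^×`, `B(1,1,λ,μ)` has
`e₁² = e₁ + e₂`, `e₂² = λe₁ + μe₂`.  `B(1,1,λ,μ) ≅ B(1,1,λ',μ')` iff `(λ,μ) = (λ',μ')`. -/
theorem stmt17 {D : Type*} [CommRing D] [IsDomain D] (l μ l' μ' : D)
    (hl : l ≠ 0) (hl' : l' ≠ 0)
    (hμ : μ ≠ 0 ∧ ¬ IsUnit μ) (hμ' : μ' ≠ 0 ∧ ¬ IsUnit μ')
    (h : IsUnit (l - μ)) (h' : IsUnit (l' - μ')) :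
    EvIso 1 1 l μ 1 1 l' μ' ↔ (l, μ) = (l', μ') := by
  constructor
  · rintro ⟨f, hf⟩
    obtain ⟨p, q, hpq⟩ : ∃ p q, f (1, 0) = (p, q) := ⟨_, _, rfl⟩
    obtain ⟨r, s, hrs⟩ : ∃ r s, f (0, 1) = (r, s) := ⟨_, _, rfl⟩
    have hlin (x y : D) : f (x, y) = (x * p + y * r, x * q + y * s) := by
      have hxy : ((x, y) : D × D) = x • (1, 0) + y • (0, 1) := by simp
      rw [hxy, map_add, map_smul, map_smul, hpq, hrs]
      simp
    have h11 := hf (1, 0) (1, 0)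
    have h12 := hf (1, 0) (0, 1)
    have h22 := hf (0, 1) (0, 1)
    simp only [evMul, hlin, Prod.mk.injEq, mul_one, one_mul, mul_zero, zero_mul, add_zero,
      zero_add] at h11 h12 h22
    have hqs : q * s = 0 := by
      refine (mul_eq_zero.mp ?_).resolve_left h'.ne_zero
      linear_combination h12.2 - h12.1
    have hpr : p * r = 0 := by linear_combination -h12.1 - l' * hqs
    have hpq0 : ¬(p = 0 ∧ q = 0) := by
      rintro ⟨rfl, rfl⟩
      have h0 := (map_eq_zero_iff f f.injective).mp hpq
      simp at h0
    have hrs0 : ¬(r = 0 ∧ s = 0) := by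
      rintro ⟨rfl, rfl⟩
      have h0 := (map_eq_zero_iff f f.injective).mp hrs
      simp at h0
    have hp : p ≠ 0 := by
      rintro rfl
      have hq : q ≠ 0 := fun hq => hpq0 ⟨rfl, hq⟩
      have hs : s = 0 := (mul_eq_zero.mp hqs).resolve_left hq
      refine hμ'.2 (IsUnit.of_mul_eq_one q (mul_left_cancel₀ hq ?_))
      linear_combination hs - h11.2
    have hr : r = 0 := (mul_eq_zero.mp hpr).resolve_left hp
    have hs : s ≠ 0 := fun hs => hrs0 ⟨hr, hs⟩
    have hq : q = 0 := (mul_eq_zero.mp hqs).resolve_right hs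
    subst hr hq
    have hp1 : p = 1 := mul_left_cancel₀ hp (by linear_combination -h11.1)
    subst hp1
    have hs1 : s = 1 := by linear_combination h11.2
    subst hs1
    ext
    · linear_combination h22.1
    · linear_combination h22.2
  · rintro ⟨⟩
    exact ⟨LinearEquiv.refl D _, fun _ _ => rfl⟩
end

section
/- For λ, μ ∈ D^*∖D^× with μ − λ ∈ D^×, let B(1,λ,1,μ) be the algebra on D² with natural basis {e₁,e₂} and multiplication e₁² = e₁ + λe₂, e₂² = e₁ + μe₂, e₁e₂ = e₂e₁ = 0. For λ, μ, λ', μ' ∈ D^*∖D^× with μ − λ ∈ D^× and μ' − λ' ∈ D^×, the algebras B(1,λ,1,μ) and B(1,λ',1,μ') are isomorphic if and only if (λ,μ) = (λ',μ') or (λ,μ) = (−λ',−μ'). -/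
/-- A linear map out of `D × D` is determined by the images of the two basis vectors. -/
theorem linearEquiv_prod_apply {D : Type*} [CommRing D] (f : (D × D) ≃ₗ[D] (D × D)) (a b : D) :
    f (a, b) = (a * (f (1, 0)).1 + b * (f (0, 1)).1, a * (f (1, 0)).2 + b * (f (0, 1)).2) := by
  have hab : ((a, b) : D × D) = a • (1, 0) + b • (0, 1) := by simp
  rw [hab, map_add, map_smul, map_smul]
  rfl

/-- An isomorphism between algebras `B(1,l,1,m)` with `l` not a unit fixes `e₁` and
maps `e₂` to `± e₂`. -/
theorem EvIso.eq_or_eq_neg {D : Type*} [CommRing D] [IsDomain D] {l m l' m' : D}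
    (hl : ¬ IsUnit l) (h' : m' - l' ≠ 0) (hiso : EvIso 1 l 1 m 1 l' 1 m') :
    (l = l' ∧ m = m') ∨ (l = -l' ∧ m = -m') := by
  obtain ⟨f, hf⟩ := hiso
  have hlin := linearEquiv_prod_apply f
  have h11 := hf (1, 0) (1, 0)
  have h12 := hf (1, 0) (0, 1)
  have h22 := hf (0, 1) (0, 1)
  obtain ⟨⟨x, y⟩, hxy⟩ := f.surjective (1, 0)
  obtain ⟨⟨z, w⟩, hzw⟩ := f.surjective (0, 1)
  rw [hlin] at hxy hzw
  simp only [evMul] at h11 h12 h22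
  rw [hlin] at h11 h12 h22
  generalize f (1, 0) = u at *
  generalize f (0, 1) = v at *
  obtain ⟨p, q⟩ := u
  obtain ⟨r, s⟩ := v
  simp only [Prod.mk.injEq, mul_one, mul_zero, one_mul, zero_mul, add_zero, zero_add]
    at h11 h12 h22 hxy hzw
  obtain ⟨h11a, h11b⟩ := h11
  obtain ⟨h12a, h12b⟩ := h12
  obtain ⟨h22a, h22b⟩ := h22
  obtain ⟨hx1, hx2⟩ := hxy
  obtain ⟨hz1, hz2⟩ := hzw
  have hqs : q * s = 0 := (mul_eq_zero.mp
    (by linear_combination l' * h12a - h12b : (m' - l') * (q * s) = 0)).resolve_left h'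
  have hpr : p * r = 0 := by linear_combination -h12a - hqs
  rcases mul_eq_zero.mp hqs with rfl | rfl
  · have hs : s ≠ 0 := by rintro rfl; simp at hz2
    have hr : r = 0 := by
      refine (mul_eq_zero.mp hpr).resolve_left ?_
      rintro rfl
      have hy : y = 0 := by simpa [hs] using hx2
      simp [hy] at hx1
    subst hr
    have hp : p ≠ 0 := by rintro rfl; simp at hx1
    have hp1 : p = 1 := mul_left_cancel₀ hp (by linear_combination -h11a)
    subst hp1
    have hss : s * s = 1 := by linear_combination -h22a
    rcases mul_self_eq_one_iff.mp hss with rfl | rfl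
    · left
      constructor
      · linear_combination h11b
      · linear_combination h22b
    · right
      constructor
      · linear_combination -h11b
      · linear_combination -h22b
  · have hp : p = 0 := by
      refine (mul_eq_zero.mp hpr).resolve_right ?_
      rintro rfl
      have hz : z * p = 0 := by simpa using hz1
      rcases mul_eq_zero.mp hz with rfl | rfl
      · simp at hz2
      · simp at hx1
    subst hp
    refine absurd (IsUnit.of_mul_eq_one (r * z * z) ?_) hl
    linear_combination z * z * h11a + (z * q + 1) * hz2

/-- For `λ, μ ∈ D^* \ D^×` with `μ - λ ∈ D^×`, `B(1,λ,1,μ)` has `e₁² = e₁ + λe₂`,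
`e₂² = e₁ + μe₂`.  `B(1,λ,1,μ) ≅ B(1,λ',1,μ')` iff `(λ,μ) = (λ',μ')` or
`(λ,μ) = (-λ',-μ')`. -/
theorem stmt18 {D : Type*} [CommRing D] [IsDomain D] (l μ l' μ' : D)
    (hl : l ≠ 0 ∧ ¬ IsUnit l) (hμ : μ ≠ 0 ∧ ¬ IsUnit μ)
    (hl' : l' ≠ 0 ∧ ¬ IsUnit l') (hμ' : μ' ≠ 0 ∧ ¬ IsUnit μ')
    (h : IsUnit (μ - l)) (h' : IsUnit (μ' - l')) :
    EvIso 1 l 1 μ 1 l' 1 μ' ↔ ((l, μ) = (l', μ') ∨ (l, μ) = (-l', -μ')) := by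
  simp only [Prod.mk.injEq]
  refine ⟨EvIso.eq_or_eq_neg hl.2 h'.ne_zero, ?_⟩
  rintro (⟨rfl, rfl⟩ | ⟨rfl, rfl⟩)
  · exact ⟨LinearEquiv.refl D _, fun x y => rfl⟩
  · refine ⟨LinearEquiv.prodCongr (LinearEquiv.refl D D) (LinearEquiv.neg D), fun x y => ?_⟩
    ext <;> simp [evMul]
    ring
end
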